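/- Let (q₀, q₀*) be a connected component of (1, M+1] \ cl(𝒰), and let q, q' ∈ 𝒱 ∩ (q₀, q₀*) with q < q' and (q, q') ∩ 𝒱 = ∅ (i.e. q and q' are consecutive elements of 𝒱 in this component). If p ∈ (q, q'), (d_i) ∈ 𝐔_{q'} \ 𝐔_q, and x := π_p((d_i)) > 0, then p is an isolated point of 𝒰(x); in particular 𝒰(x) contains an isolated point. -/

import Mathlib

open scoped ENNReal NNReal Classical

namespace Expansions

/-- Digit sequences over the alphabet `{0,1,…,M}`; index `i : ℕ` represents the
`(i+1)`-st digit `d_{i+1}` of the paper. -/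
abbrev Digits (M : ℕ) := ℕ → Fin (M + 1)

/-- `π_q((d_i)) = Σ_{i≥1} d_i / q^i`. -/
noncomputable def piQ (M : ℕ) (q : ℝ) (d : Digits M) : ℝ :=
  ∑' i : ℕ, (d i : ℝ) / q ^ (i + 1)

/-- `𝒰_q` : the set of real numbers having a unique `q`-expansion. -/
def Uq (M : ℕ) (q : ℝ) : Set ℝ := {x | ∃! d : Digits M, piQ M q d = x}

/-- `𝐔_q` : the set of sequences that are the unique `q`-expansion of their value. -/
def UqSym (M : ℕ) (q : ℝ) : Set (Digits M) :=
  {d | ∀ e : Digits M, piQ M q e = piQ M q d → e = d}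

/-- `𝒰(x)` : the set of univoque bases of `x`. -/
def Ubases (M : ℕ) (x : ℝ) : Set ℝ :=
  {q | q ∈ Set.Ioc (1 : ℝ) ((M : ℝ) + 1) ∧ x ∈ Uq M q}

/-- `q_x = min{M+1, 1+M/x}`. -/
noncomputable def qx (M : ℕ) (x : ℝ) : ℝ := min ((M : ℝ) + 1) (1 + (M : ℝ) / x)

/-- Strict lexicographic order on digit sequences. -/
def lexLt {M : ℕ} (c d : Digits M) : Prop := ∃ n, (∀ i < n, c i = d i) ∧ c n < d n

def lexLe {M : ℕ} (c d : Digits M) : Prop := c = d ∨ lexLt c d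

/-- The sequence ends with `0^∞`. -/
def EndsInZero {M : ℕ} (d : Digits M) : Prop := ∃ N, ∀ n ≥ N, d n = 0

/-- `d` is the quasi-greedy `q`-expansion of `x`: the lexicographically largest
`q`-expansion of `x` not ending with `0^∞`. -/
def IsQuasiGreedy (M : ℕ) (q x : ℝ) (d : Digits M) : Prop :=
  piQ M q d = x ∧ ¬ EndsInZero d ∧
    ∀ e : Digits M, piQ M q e = x → ¬ EndsInZero e → lexLe e d

/-- `Φ_x(q)`: the quasi-greedy `q`-expansion of `x` (junk value if none exists). -/
noncomputable def Phi (M : ℕ) (x q : ℝ) : Digits M :=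
  if h : ∃ d : Digits M, IsQuasiGreedy M q x d then h.choose else fun _ => 0

/-- `𝐔(x) = {Φ_x(q) : q ∈ 𝒰(x)}`. -/
def UxSym (M : ℕ) (x : ℝ) : Set (Digits M) := (Phi M x) '' (Ubases M x)

/-- `ρ((c_i),(d_i)) = (M+1)^{-inf{i ≥ 1 : c_i ≠ d_i}}` (our index `n` represents the
`(n+1)`-st digit, whence the exponent `-(n+1)`); `ρ(c,c) = 0`. -/
noncomputable def rho (M : ℕ) (c d : Digits M) : ℝ :=
  if c = d then 0
  else ((M : ℝ) + 1) ^ (-(((sInf {i | c i ≠ d i} : ℕ) : ℤ) + 1))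

/-- Diameter of a set with respect to a distance function, valued in `ℝ≥0∞`. -/
noncomputable def gdiam {X : Type*} (dist : X → X → ℝ) (A : Set X) : ℝ≥0∞ :=
  ⨆ x ∈ A, ⨆ y ∈ A, ENNReal.ofReal (dist x y)

/-- The `s`-dimensional Hausdorff outer measure with respect to a distance function:
`lim_{δ→0⁺} inf {Σ diam(C n)^s : A ⊆ ⋃ C n, diam (C n) ≤ δ}`. -/
noncomputable def gHMeasure {X : Type*} (dist : X → X → ℝ) (s : ℝ) (A : Set X) : ℝ≥0∞ :=
  ⨆ (δ : ℝ) (_ : 0 < δ),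
    ⨅ (C : ℕ → Set X) (_ : A ⊆ ⋃ n, C n)
      (_ : ∀ n, gdiam dist (C n) ≤ ENNReal.ofReal δ),
      ∑' n, gdiam dist (C n) ^ s

/-- Hausdorff dimension with respect to a distance function. -/
noncomputable def gdimH {X : Type*} (dist : X → X → ℝ) (A : Set X) : ℝ≥0∞ :=
  ⨆ (s : ℝ≥0) (_ : gHMeasure dist (s : ℝ) A = ⊤), (s : ℝ≥0∞)

/-- The generalized golden ratio `q_G`. -/
noncomputable def qG (M : ℕ) : ℝ :=
  if M % 2 = 0 then ((M / 2 : ℕ) : ℝ) + 1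
  else (((M / 2 : ℕ) : ℝ) + 1 +
    Real.sqrt (((M / 2 : ℕ) : ℝ) ^ 2 + 6 * ((M / 2 : ℕ) : ℝ) + 5)) / 2

/-- `x_G = M/(q_G - 1)`. -/
noncomputable def xG (M : ℕ) : ℝ := (M : ℝ) / (qG M - 1)

/-- The Komornik–Loreti constant `q_KL = min 𝒰(1)`. -/
noncomputable def qKL (M : ℕ) : ℝ := sInf (Ubases M 1)

/-- `x_KL = M/(q_KL - 1)`. -/
noncomputable def xKL (M : ℕ) : ℝ := (M : ℝ) / (qKL M - 1)

/-- `X_iso`: the set of `x > 0` such that `𝒰(x)` contains an isolated point. -/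
def Xiso (M : ℕ) : Set ℝ :=
  {x | 0 < x ∧ ∃ q ∈ Ubases M x, ∃ ε > 0, Ubases M x ∩ Set.Ioo (q - ε) (q + ε) = {q}}

/-- The bifurcation set `𝒱 = {q ∈ (1,M+1] : 𝐔_r ≠ 𝐔_q for all r > q}`. -/
def Vset (M : ℕ) : Set ℝ :=
  {q | q ∈ Set.Ioc (1 : ℝ) ((M : ℝ) + 1) ∧
    ∀ r ∈ Set.Ioc (1 : ℝ) ((M : ℝ) + 1), q < r → UqSym M r ≠ UqSym M q}

/-- The Thue–Morse sequence `τ_i` = parity of the binary digit sum of `i`. -/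
def tm (i : ℕ) : ℕ := (Nat.digits 2 i).sum % 2

section Values

variable {M : ℕ} {q r : ℝ}

/-- The `n`-fold left shift of a digit sequence. -/
def shift (n : ℕ) (d : Digits M) : Digits M := fun i => d (i + n)

/-- The reflection `d_i ↦ M - d_i` of a digit sequence. -/
def refl (d : Digits M) : Digits M := fun i => Fin.rev (d i)

@[simp] theorem shift_apply (n : ℕ) (d : Digits M) (i : ℕ) : shift n d i = d (i + n) := rfl

@[simp] theorem shift_zero (d : Digits M) : shift 0 d = d := rfl

theorem shift_shift (m n : ℕ) (d : Digits M) : shift m (shift n d) = shift (m + n) d := by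
  funext i; simp [add_assoc]

@[simp] theorem refl_apply (d : Digits M) (i : ℕ) : refl d i = Fin.rev (d i) := rfl

@[simp] theorem refl_refl (d : Digits M) : refl (refl d) = d := by
  funext i; simp

theorem refl_shift (n : ℕ) (d : Digits M) : refl (shift n d) = shift n (refl d) := rfl

theorem val_rev (a : Fin (M + 1)) : ((Fin.rev a : Fin (M + 1)) : ℕ) = M - a := by
  rw [Fin.val_rev]; omega

theorem digit_le (a : Fin (M + 1)) : (a : ℕ) ≤ M := by omega

theorem cast_rev (a : Fin (M + 1)) : (((Fin.rev a : Fin (M + 1)) : ℕ) : ℝ) = M - (a : ℕ) := by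
  rw [val_rev, Nat.cast_sub (digit_le a)]

theorem digit_cast_le (a : Fin (M + 1)) : ((a : ℕ) : ℝ) ≤ M := by
  exact_mod_cast digit_le a

theorem hasSum_const_div (hq : 1 < q) (c : ℝ) :
    HasSum (fun i : ℕ => c / q ^ (i + 1)) (c / (q - 1)) := by
  have h0 : 0 < q := by linarith
  have h := (hasSum_geometric_of_lt_one (inv_nonneg.2 h0.le) (inv_lt_one_of_one_lt₀ hq)).mul_left
    (c / q)
  have e : c / q * (1 - q⁻¹)⁻¹ = c / (q - 1) := by
    have : q - 1 ≠ 0 := by linarith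
    have h2 : 1 - q⁻¹ ≠ 0 := by
      have := inv_lt_one_of_one_lt₀ hq
      linarith
    field_simp
  rw [e] at h
  refine h.congr_fun ?_
  intro i
  rw [pow_succ, inv_pow]
  field_simp

theorem summable_digits (hq : 1 < q) (d : Digits M) :
    Summable (fun i : ℕ => (d i : ℝ) / q ^ (i + 1)) := by
  have h0 : 0 < q := by linarith
  refine Summable.of_nonneg_of_le (fun i => by positivity) (fun i => ?_)
    (hasSum_const_div hq (M : ℝ)).summable
  have := digit_cast_le (d i)
  gcongr

theorem piQ_nonneg (hq : 1 < q) (d : Digits M) : 0 ≤ piQ M q d := by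
  have h0 : 0 < q := by linarith
  exact tsum_nonneg fun i => by positivity

theorem piQ_le (hq : 1 < q) (d : Digits M) : piQ M q d ≤ M / (q - 1) := by
  have h0 : 0 < q := by linarith
  rw [← (hasSum_const_div hq (M : ℝ)).tsum_eq]
  refine (summable_digits hq d).tsum_le_tsum (fun i => ?_) (hasSum_const_div hq (M : ℝ)).summable
  have := digit_cast_le (d i)
  gcongr

theorem piQ_refl (hq : 1 < q) (d : Digits M) : piQ M q (refl d) = M / (q - 1) - piQ M q d := by
  rw [← (hasSum_const_div hq (M : ℝ)).tsum_eq, piQ, piQ,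
    ← (hasSum_const_div hq (M : ℝ)).summable.tsum_sub (summable_digits hq d)]
  refine tsum_congr fun i => ?_
  rw [refl_apply, cast_rev]
  ring

theorem piQ_pos (hq : 1 < q) {d : Digits M} {i : ℕ} (hi : 0 < (d i : ℕ)) : 0 < piQ M q d := by
  have h0 : 0 < q := by linarith
  refine (summable_digits hq d).tsum_pos (fun i => by positivity) i ?_
  have : (0 : ℝ) < (d i : ℕ) := by exact_mod_cast hi
  positivity

theorem piQ_cons (hq : 1 < q) (d : Digits M) :
    piQ M q d = ((d 0 : ℕ) + piQ M q (shift 1 d)) / q := by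
  have h0 : 0 < q := by linarith
  rw [piQ, (summable_digits hq d).tsum_eq_zero_add, piQ, add_div, ← tsum_div_const]
  congr 1
  · simp
  · refine tsum_congr fun i => ?_
    rw [shift_apply, div_div, ← pow_succ]

theorem piQ_sub_of_eq (hq : 1 < q) {d e : Digits M} {n : ℕ} (h : ∀ i < n, d i = e i) :
    piQ M q d - piQ M q e = (piQ M q (shift n d) - piQ M q (shift n e)) / q ^ n := by
  have h0 : 0 < q := by linarith
  induction n generalizing d e with
  | zero => simp
  | succ n ih =>
    have := ih (d := shift 1 d) (e := shift 1 e) fun i hi => h (i + 1) (by omega)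
    rw [shift_shift, shift_shift] at this
    rw [piQ_cons hq d, piQ_cons hq e, h 0 (by omega), ← sub_div, add_sub_add_left_eq_sub, this,
      div_div, pow_succ]

/-- Values of two sequences that agree up to index `n`, compared through their tails. -/
theorem piQ_sub_of_eq_succ (hq : 1 < q) {d e : Digits M} {n : ℕ} (h : ∀ i < n, d i = e i) :
    piQ M q d - piQ M q e =
      ((d n : ℕ) - (e n : ℕ) + piQ M q (shift (n + 1) d) - piQ M q (shift (n + 1) e)) /
        q ^ (n + 1) := by
  have h0 : 0 < q := by linarith
  rw [piQ_sub_of_eq hq h, piQ_cons hq (shift n d), piQ_cons hq (shift n e), shift_shift,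
    shift_shift, add_comm 1 n, pow_succ]
  simp only [shift_apply, zero_add]
  field_simp
  ring

theorem piQ_antitone (hq : 1 < q) (hqr : q ≤ r) (d : Digits M) : piQ M r d ≤ piQ M q d := by
  have h0 : 0 < q := by linarith
  refine (summable_digits (hq.trans_le hqr) d).tsum_le_tsum (fun i => ?_) (summable_digits hq d)
  gcongr

theorem piQ_lt_of_lt (hq : 1 < q) (hqr : q < r) {d : Digits M} (hd : 0 < piQ M q d) :
    piQ M r d < piQ M q d := by
  have h0 : 0 < q := by linarith
  obtain ⟨j, hj⟩ : ∃ j, 0 < (d j : ℕ) := by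
    by_contra! h
    have : piQ M q d = 0 := by
      rw [piQ]
      convert tsum_zero with i
      have := h i
      have h1 : (d i : ℕ) = 0 := by omega
      simp [h1]
    linarith
  refine (summable_digits (hq.trans hqr) d).tsum_lt_tsum (i := j) (fun i => ?_) ?_
    (summable_digits hq d)
  · gcongr
  · have : (0 : ℝ) < (d j : ℕ) := by exact_mod_cast hj
    gcongr

theorem exists_digits (hq : 1 < q) (hqM : q ≤ M + 1) {x : ℝ} (hx : 0 ≤ x)
    (hxM : x ≤ M / (q - 1)) : ∃ d : Digits M, piQ M q d = x := by
  have h0 : 0 < q := by linarith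
  have h1 : 0 < q - 1 := by linarith
  have step : ∀ y : Set.Icc (0 : ℝ) (M / (q - 1)), ∃ a : Fin (M + 1),
      q * y.1 - (a : ℕ) ∈ Set.Icc (0 : ℝ) (M / (q - 1)) := by
    rintro ⟨y, hy0, hyM⟩
    have hqy : 0 ≤ q * y := by positivity
    by_cases hf : (M : ℝ) ≤ q * y
    · refine ⟨⟨M, by omega⟩, by simpa using hf, ?_⟩
      have : q * y ≤ q * (M / (q - 1)) := by gcongr
      have e : q * (M / (q - 1)) - M = M / (q - 1) := by field_simp; ring
      simp only
      linarith
    · have hlt : ⌊q * y⌋₊ < M := (Nat.floor_lt hqy).2 (not_le.1 hf)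
      refine ⟨⟨⌊q * y⌋₊, by omega⟩, sub_nonneg.2 (Nat.floor_le hqy), ?_⟩
      have := Nat.lt_floor_add_one (q * y)
      have h2 : 1 ≤ (M : ℝ) / (q - 1) := by rw [le_div_iff₀ h1]; linarith
      simp only
      linarith
  choose f hf using step
  let y : ℕ → Set.Icc (0 : ℝ) (M / (q - 1)) := fun n =>
    Nat.rec ⟨x, hx, hxM⟩ (fun _ z => ⟨q * z.1 - (f z : ℕ), hf z⟩) n
  have hy : ∀ n, (y (n + 1)).1 = q * (y n).1 - ((f (y n) : ℕ) : ℝ) := fun n => rfl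
  refine ⟨fun n => f (y n), ?_⟩
  have key : ∀ n, ∑ i ∈ Finset.range n, ((f (y i) : ℕ) : ℝ) / q ^ (i + 1) = x - (y n).1 / q ^ n := by
    intro n
    induction n with
    | zero => simp [y]
    | succ n ih =>
      rw [Finset.sum_range_succ, ih, hy, pow_succ]
      field_simp
      ring
  have hs := (summable_digits hq (fun n => f (y n))).hasSum.tendsto_sum_nat
  refine tendsto_nhds_unique hs ?_
  simp only [key]
  have hz : Filter.Tendsto (fun n => (y n).1 / q ^ n) Filter.atTop (nhds 0) := by
    have hg : Filter.Tendsto (fun n : ℕ => (M / (q - 1)) / q ^ n) Filter.atTop (nhds 0) :=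
      Filter.Tendsto.div_atTop tendsto_const_nhds (tendsto_pow_atTop_atTop_of_one_lt hq)
    refine squeeze_zero (fun n => ?_) (fun n => ?_) hg
    · have := (y n).2.1
      positivity
    · have := (y n).2.2
      gcongr
  simpa using tendsto_const_nhds.sub hz

/-- A sequence is a unique expansion iff its tails satisfy the usual bounds by `1`. -/
theorem mem_UqSym_iff (hq : 1 < q) (hqM : q ≤ M + 1) (d : Digits M) :
    d ∈ UqSym M q ↔ ∀ n, ((d n : ℕ) < M → piQ M q (shift (n + 1) d) < 1) ∧
      (0 < (d n : ℕ) → piQ M q (refl (shift (n + 1) d)) < 1) := by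
  have h0 : 0 < q := by linarith
  have h1 : 0 < q - 1 := by linarith
  constructor
  · have main : ∀ d ∈ UqSym M q, ∀ n, (d n : ℕ) < M → piQ M q (shift (n + 1) d) < 1 := by
      intro d hd n hn
      by_contra! hle
      obtain ⟨e, he⟩ := exists_digits (M := M) hq hqM (x := piQ M q (shift (n + 1) d) - 1)
        (by linarith) (by linarith [piQ_le hq (shift (n + 1) d)])
      let g : Digits M := fun i =>
        if i < n then d i else if i = n then ⟨d n + 1, by omega⟩ else e (i - (n + 1))
      have hg : shift (n + 1) g = e := by
        funext i
        simp only [shift_apply, g]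
        rw [if_neg (by omega), if_neg (by omega), Nat.add_sub_cancel]
      have hgn : (g n : ℕ) = d n + 1 := by simp [g]
      have heq := piQ_sub_of_eq_succ hq (d := g) (e := d) (n := n) fun i hi => by simp [g, hi]
      rw [hg, he, hgn] at heq
      have : piQ M q g = piQ M q d := by
        rw [← sub_eq_zero, heq]
        push_cast
        ring
      have := congrFun (hd g this) n
      rw [this] at hgn
      omega
    intro hd n
    refine ⟨main d hd n, fun hn => ?_⟩
    refine main (refl d) (fun e he => ?_) n ?_
    · rw [← refl_refl e, hd (refl e) (by rw [piQ_refl hq, he, piQ_refl hq]; ring)]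
    · rw [refl_apply, val_rev]; omega
  · intro h e he
    by_contra hne
    have hex : ∃ n, e n ≠ d n := by
      by_contra! hc
      exact hne (funext hc)
    have hmin : ∀ i < Nat.find hex, e i = d i := fun i hi => not_not.1 (Nat.find_min hex hi)
    have hn := Nat.find_spec hex
    set n := Nat.find hex
    have heq := piQ_sub_of_eq_succ hq hmin
    rw [he, sub_self, eq_comm, div_eq_zero_iff, or_iff_left (by positivity)] at heq
    have hv : (e n : ℕ) ≠ d n := fun hc => hn (Fin.ext hc)
    rcases lt_or_gt_of_ne hv with hlt | hgt
    · have h2 := (h n).2 (by omega)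
      rw [piQ_refl hq] at h2
      have h3 := piQ_le hq (shift (n + 1) e)
      have : ((e n : ℕ) : ℝ) + 1 ≤ (d n : ℕ) := by exact_mod_cast hlt
      linarith
    · have h2 := (h n).1 (by have := digit_le (e n); omega)
      have h3 := piQ_nonneg hq (shift (n + 1) e)
      have : ((d n : ℕ) : ℝ) + 1 ≤ (e n : ℕ) := by exact_mod_cast hgt
      linarith

theorem refl_mem_UqSym (hq : 1 < q) {d : Digits M} (hd : d ∈ UqSym M q) :
    refl d ∈ UqSym M q := by
  intro e he
  rw [← refl_refl e, hd (refl e) (by rw [piQ_refl hq, he, piQ_refl hq]; ring)]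

theorem UqSym_mono (hq : 1 < q) (hqr : q ≤ r) (hrM : r ≤ M + 1) : UqSym M q ⊆ UqSym M r := by
  intro d hd
  rw [mem_UqSym_iff hq (hqr.trans hrM)] at hd
  rw [mem_UqSym_iff (hq.trans_le hqr) hrM]
  exact fun n => ⟨fun h => (piQ_antitone hq hqr _).trans_lt ((hd n).1 h),
    fun h => (piQ_antitone hq hqr _).trans_lt ((hd n).2 h)⟩

theorem continuousOn_piQ : ContinuousOn (fun z : ℝ × Digits M => piQ M z.1 z.2)
    (Set.Ioi 1 ×ˢ Set.univ) := by
  rintro ⟨q, d⟩ ⟨hq, -⟩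
  have hq : 1 < q := hq
  obtain ⟨t, ht1, htq⟩ := exists_between hq
  have ht0 : 0 < t := by linarith
  have hc : ContinuousOn (fun z : ℝ × Digits M => piQ M z.1 z.2) (Set.Ioi t ×ˢ Set.univ) := by
    refine continuousOn_tsum (u := fun i => (M : ℝ) / t ^ (i + 1)) (fun i => ?_)
      (hasSum_const_div ht1 (M : ℝ)).summable ?_
    · refine ContinuousOn.div ?_ (by fun_prop) ?_
      · have : Continuous (fun a : Fin (M + 1) => ((a : ℕ) : ℝ)) := continuous_of_discreteTopology
        exact (this.comp ((continuous_apply i).comp continuous_snd)).continuousOn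
      · rintro ⟨s, e⟩ ⟨hs, -⟩
        have hs : t < s := hs
        have : 0 < s := by linarith
        positivity
    · rintro i ⟨s, e⟩ ⟨hs, -⟩
      have hs : t < s := hs
      have h0 : 0 < s := by linarith
      have := digit_cast_le (e i)
      rw [Real.norm_of_nonneg (by positivity)]
      simp only
      gcongr
  have hmem : Set.Ioi t ×ˢ Set.univ ∈ nhds (q, d) :=
    (isOpen_Ioi.prod isOpen_univ).mem_nhds ⟨htq, trivial⟩
  exact (hc.continuousAt hmem).continuousWithinAt

theorem continuous_piQ (hq : 1 < q) : Continuous (piQ M q) := by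
  have := continuousOn_piQ.comp_continuous (f := fun d : Digits M => (q, d)) (by fun_prop)
    (fun d => ⟨hq, trivial⟩)
  exact this

theorem continuousOn_piQ_base (d : Digits M) : ContinuousOn (fun q => piQ M q d) (Set.Ioi 1) :=
  continuousOn_piQ.comp (f := fun q : ℝ => (q, d)) (by fun_prop) fun _ hq => ⟨hq, trivial⟩

theorem continuous_shift (n : ℕ) : Continuous (shift (M := M) n) :=
  continuous_pi fun i => continuous_apply (i + n)

theorem continuous_refl : Continuous (refl (M := M)) :=
  continuous_pi fun i => (continuous_of_discreteTopology (f := Fin.rev)).comp (continuous_apply i)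

end Values

section Lexicographic

variable {M : ℕ} {q r : ℝ} {c d e : Digits M}

theorem lexLt_iff_toLex : lexLt c d ↔ toLex c < toLex d := Iff.rfl

theorem lexLe_iff_toLex : lexLe c d ↔ toLex c ≤ toLex d := by
  rw [le_iff_eq_or_lt, toLex_inj]; exact Iff.rfl

theorem not_lexLt : ¬ lexLt c d ↔ lexLe d c := by
  rw [lexLt_iff_toLex, lexLe_iff_toLex]; exact not_lt

theorem not_lexLe : ¬ lexLe c d ↔ lexLt d c := by
  rw [lexLt_iff_toLex, lexLe_iff_toLex]; exact not_le

theorem lexLe.trans (h : lexLe c d) (h' : lexLe d e) : lexLe c e := by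
  rw [lexLe_iff_toLex] at *; exact h.trans h'

theorem lexLt.le (h : lexLt c d) : lexLe c d := Or.inr h

theorem lexLt.ne (h : lexLt c d) : c ≠ d := by
  rintro rfl
  exact lt_irrefl _ (lexLt_iff_toLex.1 h)

theorem lexLe.antisymm (h : lexLe c d) (h' : lexLe d c) : c = d := by
  rw [lexLe_iff_toLex] at *; exact toLex_inj.1 (h.antisymm h')

theorem lexLe.lt_of_ne (h : lexLe c d) (h' : c ≠ d) : lexLt c d := h.resolve_left h'

theorem lexLt.reflect (h : lexLt c d) : lexLt (refl d) (refl c) := by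
  obtain ⟨n, hn, hlt⟩ := h
  exact ⟨n, fun i hi => by simp [hn i hi], by simpa using hlt⟩

theorem lexLe.reflect (h : lexLe c d) : lexLe (refl d) (refl c) := by
  rcases h with rfl | h
  · exact Or.inl rfl
  · exact Or.inr h.reflect

theorem lexLt_of_shift {n : ℕ} (h : ∀ i < n, c i = d i) (h' : lexLt (shift n c) (shift n d)) :
    lexLt c d := by
  obtain ⟨k, hk, hlt⟩ := h'
  refine ⟨k + n, fun i hi => ?_, hlt⟩
  by_cases hin : i < n
  · exact h i hin
  · have := hk (i - n) (by omega)
    simpa [Nat.sub_add_cancel (not_lt.1 hin)] using this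

theorem eq_of_shift {n : ℕ} (h : ∀ i < n, c i = d i) (h' : shift n c = shift n d) : c = d := by
  funext i
  by_cases hin : i < n
  · exact h i hin
  · have := congrFun h' (i - n)
    simpa [Nat.sub_add_cancel (not_lt.1 hin)] using this

theorem lexLe_of_shift {n : ℕ} (h : ∀ i < n, c i = d i) (h' : lexLe (shift n c) (shift n d)) :
    lexLe c d := by
  rcases h' with h' | h'
  · exact Or.inl (eq_of_shift h h')
  · exact Or.inr (lexLt_of_shift h h')

theorem lexLe_shift {n : ℕ} (h : ∀ i < n, c i = d i) (h' : lexLe c d) :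
    lexLe (shift n c) (shift n d) := by
  rw [← not_lexLt] at h' ⊢
  exact fun hc => h' (lexLt_of_shift (fun i hi => (h i hi).symm) hc)

/-- `c` and `d` have the same first `n` digits. -/
def EqUpTo (n : ℕ) (c d : Digits M) : Prop := ∀ i < n, c i = d i

/-- `c` is lexicographically smaller than `d`, with first difference among the first `n` digits. -/
def LtUpTo (n : ℕ) (c d : Digits M) : Prop := ∃ k < n, (∀ i < k, c i = d i) ∧ c k < d k

theorem LtUpTo.lexLt {n : ℕ} (h : LtUpTo n c d) : lexLt c d := by
  obtain ⟨k, -, h⟩ := h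
  exact ⟨k, h⟩

theorem LtUpTo.mono {m n : ℕ} (hmn : m ≤ n) (h : LtUpTo m c d) : LtUpTo n c d := by
  obtain ⟨k, hk, h⟩ := h
  exact ⟨k, hk.trans_le hmn, h⟩

theorem LtUpTo.reflect {n : ℕ} (h : LtUpTo n c d) : LtUpTo n (refl d) (refl c) := by
  obtain ⟨k, hk, hn, hlt⟩ := h
  exact ⟨k, hk, fun i hi => by simp [hn i hi], by simpa using hlt⟩

theorem lexLe.upTo (h : lexLe c d) (n : ℕ) : EqUpTo n c d ∨ LtUpTo n c d := by
  rcases h with rfl | ⟨k, hk, hlt⟩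
  · exact Or.inl fun _ _ => rfl
  · by_cases hkn : k < n
    · exact Or.inr ⟨k, hkn, hk, hlt⟩
    · exact Or.inl fun i hi => hk i (by omega)

theorem LtUpTo.not_lexLe {n : ℕ} (h : LtUpTo n c d) : ¬ lexLe d c :=
  fun h' => not_lexLt.2 h' h.lexLt

theorem LtUpTo.congr {n : ℕ} {c' d' : Digits M} (h : LtUpTo n c d) (hc : EqUpTo n c' c)
    (hd : EqUpTo n d' d) : LtUpTo n c' d' := by
  obtain ⟨k, hk, hn, hlt⟩ := h
  refine ⟨k, hk, fun i hi => ?_, ?_⟩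
  · rw [hc i (by omega), hd i (by omega), hn i hi]
  · rw [hc k hk, hd k hk]; exact hlt

theorem EqUpTo.ltUpTo_add {m n : ℕ} (h : EqUpTo m c d) (h' : LtUpTo n (shift m c) (shift m d)) :
    LtUpTo (m + n) c d := by
  obtain ⟨k, hk, hn, hlt⟩ := h'
  refine ⟨k + m, by omega, fun i hi => ?_, hlt⟩
  by_cases him : i < m
  · exact h i him
  · have := hn (i - m) (by omega)
    simpa [Nat.sub_add_cancel (not_lt.1 him)] using this

theorem piQ_le_one_of_lexLe (hq : 1 < q) {b : Digits M} (hb : piQ M q b = 1) (he : lexLe e b)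
    (hin : ∀ j, (e j : ℕ) < M → lexLe (shift (j + 1) e) b) : piQ M q e ≤ 1 := by
  have h0 : 0 < q := by linarith
  have hB : (0 : ℝ) ≤ M / (q - 1) := div_nonneg (Nat.cast_nonneg _) (by linarith)
  have key : ∀ k : ℕ, ∀ e : Digits M, lexLe e b →
      (∀ j, (e j : ℕ) < M → lexLe (shift (j + 1) e) b) →
      piQ M q e ≤ 1 + M / (q - 1) / q ^ k := by
    intro k
    induction k with
    | zero =>
      intro e _ _
      have := piQ_le hq e
      simp only [pow_zero, div_one]
      linarith
    | succ k ih =>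
      intro e he hin
      rcases he with rfl | ⟨n, hn, hlt⟩
      · rw [hb]
        have : 0 ≤ (M : ℝ) / (q - 1) / q ^ (k + 1) := by positivity
        linarith
      · have hlt' : (e n : ℕ) < b n := hlt
        have hs := ih (shift (n + 1) e) (hin n (by have := digit_le (b n); omega)) fun j hj => by
          rw [shift_shift, add_right_comm]
          exact hin (j + (n + 1)) hj
        have heq := piQ_sub_of_eq_succ hq hn
        have h1 : ((e n : ℕ) : ℝ) + 1 ≤ (b n : ℕ) := by exact_mod_cast hlt'
        have h2 := piQ_nonneg hq (shift (n + 1) b)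
        have h3 : piQ M q e - piQ M q b ≤ (M / (q - 1) / q ^ k) / q ^ (n + 1) := by
          rw [heq]
          gcongr
          linarith
        have h4 : (M / (q - 1) / q ^ k) / q ^ (n + 1) ≤ (M / (q - 1) / q ^ k) / q := by
          gcongr
          exact le_self_pow₀ hq.le (by omega)
        rw [div_div _ (q ^ k) q, ← pow_succ] at h4
        linarith
  have hlim : Filter.Tendsto (fun k : ℕ => 1 + M / (q - 1) / q ^ k) Filter.atTop (nhds (1 + 0)) :=
    tendsto_const_nhds.add
      (tendsto_const_nhds.div_atTop (tendsto_pow_atTop_atTop_of_one_lt hq))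
  rw [add_zero] at hlim
  exact ge_of_tendsto' hlim fun k => key k e he hin

theorem piQ_lt_one_of_lexLt (hq : 1 < q) {b : Digits M} (hb : piQ M q b = 1)
    (hpos : ∀ n, 0 < piQ M q (shift n b)) (he : lexLt e b)
    (hin : ∀ j, (e j : ℕ) < M → lexLe (shift (j + 1) e) b) : piQ M q e < 1 := by
  have h0 : 0 < q := by linarith
  obtain ⟨n, hn, hlt⟩ := he
  have hlt' : (e n : ℕ) < b n := hlt
  have hs : piQ M q (shift (n + 1) e) ≤ 1 :=
    piQ_le_one_of_lexLe hq hb (hin n (by have := digit_le (b n); omega)) fun j hj => by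
      rw [shift_shift, add_right_comm]
      exact hin (j + (n + 1)) hj
  have heq := piQ_sub_of_eq_succ hq hn
  have h1 : ((e n : ℕ) : ℝ) + 1 ≤ (b n : ℕ) := by exact_mod_cast hlt'
  have h2 := hpos (n + 1)
  have h3 : piQ M q e - piQ M q b < 0 := by
    rw [heq]
    exact div_neg_of_neg_of_pos (by linarith) (by positivity)
  linarith

theorem one_add_le_piQ_of_lexLt (hq : 1 < q) {b : Digits M} (hb : piQ M q b = 1)
    (hin : ∀ j, (b j : ℕ) < M → piQ M q (shift (j + 1) b) ≤ 1) (he : lexLt b e) :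
    ∃ n, 1 + piQ M q (shift n e) / q ^ n ≤ piQ M q e := by
  have h0 : 0 < q := by linarith
  obtain ⟨n, hn, hlt⟩ := he
  have hlt' : (b n : ℕ) < e n := hlt
  have hs := hin n (by have := digit_le (e n); omega)
  have heq := piQ_sub_of_eq_succ hq fun i hi => (hn i hi).symm
  have h1 : ((b n : ℕ) : ℝ) + 1 ≤ (e n : ℕ) := by exact_mod_cast hlt'
  refine ⟨n + 1, ?_⟩
  have h3 : piQ M q (shift (n + 1) e) / q ^ (n + 1) ≤ piQ M q e - piQ M q b := by
    rw [heq]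
    gcongr
    linarith
  linarith

theorem one_le_piQ_of_lexLt (hq : 1 < q) {b : Digits M} (hb : piQ M q b = 1)
    (hin : ∀ j, (b j : ℕ) < M → piQ M q (shift (j + 1) b) ≤ 1) (he : lexLt b e) :
    1 ≤ piQ M q e := by
  obtain ⟨n, hn⟩ := one_add_le_piQ_of_lexLt hq hb hin he
  have : 0 ≤ piQ M q (shift n e) / q ^ n := div_nonneg (piQ_nonneg hq _) (by positivity)
  linarith

theorem piQ_pos_of_lexLt (hq : 1 < q) (h : lexLt c d) : 0 < piQ M q d := by
  obtain ⟨n, -, hn⟩ := h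
  have : (c n : ℕ) < d n := hn
  exact piQ_pos hq (i := n) (by omega)

/-- A strictly admissible expansion of `1` is the unique one. -/
theorem mem_Ubases_one (hq : 1 < q) (hqM : q ≤ M + 1) (hc : piQ M q c = 1)
    (hlt : ∀ n, lexLt (shift (n + 1) c) c) (hgt : ∀ n, lexLt (refl c) (shift (n + 1) c)) :
    q ∈ Ubases M 1 := by
  have hpos : ∀ n, 0 < piQ M q (shift n c) := by
    rintro (_ | n)
    · rw [shift_zero, hc]; exact one_pos
    · exact piQ_pos_of_lexLt hq (hgt n)
  have hlt' : ∀ n, lexLt (refl (shift (n + 1) c)) c := fun n => by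
    have := (hgt n).reflect
    rwa [refl_refl] at this
  have hmem : c ∈ UqSym M q := by
    rw [mem_UqSym_iff hq hqM]
    refine fun n => ⟨fun _ => ?_, fun _ => ?_⟩
    · refine piQ_lt_one_of_lexLt hq hc hpos (hlt n) fun j _ => ?_
      rw [shift_shift]
      exact (hlt (j + 1 + n)).le
    · refine piQ_lt_one_of_lexLt hq hc hpos (hlt' n) fun j _ => ?_
      rw [← refl_shift, shift_shift]
      exact (hlt' (j + 1 + n)).le
  exact ⟨⟨hq, hqM⟩, c, hc, fun e he => hmem e (by rw [he, hc])⟩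

/-- `b` is an expansion of `1` in base `q` whose shifts lie lexicographically between its
reflection and itself. -/
structure Admissible (M : ℕ) (q : ℝ) (b : Digits M) : Prop where
  value : piQ M q b = 1
  le : ∀ n, lexLe (shift n b) b
  ge : ∀ n, lexLe (refl b) (shift n b)

theorem Admissible.refl_le {b : Digits M} (h : Admissible M q b) (n : ℕ) :
    lexLe (refl (shift n b)) b := by
  have := (h.ge n).reflect
  rwa [refl_refl] at this

theorem Admissible.piQ_shift_le (hq : 1 < q) {b : Digits M} (h : Admissible M q b) (n : ℕ) :
    piQ M q (shift n b) ≤ 1 :=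
  piQ_le_one_of_lexLe hq h.value (h.le n) fun j _ => by rw [shift_shift]; exact h.le _

theorem Admissible.piQ_refl_shift_le (hq : 1 < q) {b : Digits M} (h : Admissible M q b) (n : ℕ) :
    piQ M q (refl (shift n b)) ≤ 1 :=
  piQ_le_one_of_lexLe hq h.value (h.refl_le n) fun j _ => by
    rw [← refl_shift, shift_shift]; exact h.refl_le _

theorem Admissible.lexLt_of_mem (hq : 1 < q) (hqM : q ≤ M + 1) {b : Digits M}
    (h : Admissible M q b) (hd : d ∈ UqSym M q) {n : ℕ} (hn : (d n : ℕ) < M) :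
    lexLt (shift (n + 1) d) b := by
  have hlt := ((mem_UqSym_iff hq hqM d).1 hd n).1 hn
  rw [← not_lexLe]
  rintro (he | he)
  · rw [← he, h.value] at hlt
    exact lt_irrefl _ hlt
  · exact (one_le_piQ_of_lexLt hq h.value (fun j _ => h.piQ_shift_le hq _) he).not_gt hlt

/-- If all tails are bounded by `1` in value, then an expansion of `1` is admissible. -/
theorem admissible_of_values (hq : 1 < q) (hqM : q < M + 1) {b : Digits M}
    (hb : piQ M q b = 1) (hle : ∀ n, (b n : ℕ) < M → piQ M q (shift (n + 1) b) ≤ 1)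
    (hge : ∀ n, 0 < (b n : ℕ) → piQ M q (refl (shift (n + 1) b)) ≤ 1) :
    Admissible M q b ∧ ∀ n, 0 < piQ M q (shift n b) := by
  have h1 : 0 < q - 1 := by linarith
  have hB : 1 < (M : ℝ) / (q - 1) := by rw [lt_div_iff₀ h1]; linarith
  have hpos : ∀ n, 0 < piQ M q (shift n b) ∧ 0 < piQ M q (refl (shift n b)) := by
    intro n
    induction n with
    | zero =>
      rw [shift_zero, piQ_refl hq, hb]
      exact ⟨one_pos, by linarith⟩
    | succ n ih =>
      have e1 := piQ_cons hq (shift n b)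
      have e2 := piQ_cons hq (refl (shift n b))
      rw [← refl_shift, shift_shift, add_comm 1 n] at e2
      rw [shift_shift, add_comm 1 n] at e1
      simp only [refl_apply, shift_apply, zero_add, cast_rev] at e1 e2
      have hr := piQ_refl hq (shift (n + 1) b)
      constructor
      · refine (piQ_nonneg hq _).lt_of_ne fun h => ?_
        rw [← h] at hr e1
        rcases Nat.eq_zero_or_pos (b n : ℕ) with hz | hz
        · rw [hz] at e1
          norm_num at e1
          linarith [ih.1]
        · linarith [hge n hz]
      · refine (piQ_nonneg hq _).lt_of_ne fun h => ?_
        rw [← h] at hr e2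
        rcases (digit_le (b n)).eq_or_lt with hz | hz
        · rw [hz] at e2
          norm_num at e2
          linarith [ih.2]
        · linarith [hle n hz]
  have hlex : ∀ e : Digits M, (∀ n, 0 < piQ M q (shift n e)) → piQ M q e ≤ 1 → lexLe e b := by
    intro e he he1
    rw [← not_lexLt]
    intro hlt
    obtain ⟨n, hn⟩ := one_add_le_piQ_of_lexLt hq hb hle hlt
    have := he n
    have : 0 < piQ M q (shift n e) / q ^ n := by positivity
    linarith
  have hone : lexLe (shift 1 b) b := by
    by_cases hall : ∀ n, b n = Fin.last M
    · left
      funext i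
      simp [hall]
    · push Not at hall
      have hmin : ∀ i < Nat.find hall, b i = Fin.last M :=
        fun i hi => not_not.1 (Nat.find_min hall hi)
      have hs := Nat.find_spec hall
      set n := Nat.find hall
      have hv : (b n : ℕ) < M := by
        have := digit_le (b n)
        have : (b n : ℕ) ≠ M := fun h => hs (Fin.ext h)
        omega
      rcases Nat.eq_zero_or_pos n with hz | hz
      · refine hlex _ (fun k => ?_) (hle 0 (hz ▸ hv))
        rw [shift_shift]
        exact (hpos _).1
      · right
        refine ⟨n - 1, fun i hi => ?_, ?_⟩
        · rw [shift_apply, hmin _ (by omega), hmin _ (by omega)]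
        · rw [shift_apply, Nat.sub_add_cancel hz, hmin (n - 1) (by omega)]
          exact hv
  have hlexle : ∀ n, lexLe (shift n b) b := by
    intro n
    induction n with
    | zero => exact Or.inl rfl
    | succ n ih =>
      by_cases hn : (b n : ℕ) < M
      · refine hlex _ (fun k => ?_) (hle n hn)
        rw [shift_shift]
        exact (hpos _).1
      · have hbn : b n = Fin.last M := Fin.ext (by have := digit_le (b n); simp; omega)
        have h0 : b 0 = Fin.last M := by
          rcases ih.upTo 1 with h | ⟨k, hk, -, h⟩
          · rw [← h 0 one_pos]; simpa using hbn
          · obtain rfl : k = 0 := by omega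
            rw [shift_apply, zero_add, hbn] at h
            exact absurd h (Fin.not_lt.2 (Fin.le_last _))
        have := lexLe_shift (n := 1) (fun i hi => by
          obtain rfl : i = 0 := by omega
          simp [hbn, h0]) ih
        rw [shift_shift, add_comm 1 n] at this
        exact this.trans hone
  have hlexge : ∀ n, lexLe (refl b) (shift (n + 1) b) := by
    have hzero : 0 < (b 0 : ℕ) := by
      by_contra! h
      have hall : ∀ n, (b n : ℕ) = 0 := fun n => by
        rcases (hlexle n).upTo 1 with h' | ⟨k, hk, -, h'⟩
        · have := h' 0 one_pos
          simp only [shift_apply, zero_add] at this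
          rw [this]; omega
        · obtain rfl : k = 0 := by omega
          have : (b (0 + n) : ℕ) < b 0 := h'
          omega
      have : piQ M q b = 0 := by simp [piQ, hall]
      linarith
    have hbase : ∀ n, 0 < (b n : ℕ) → lexLe (refl b) (shift (n + 1) b) := by
      intro n hn
      have := hlex _ (fun k => ?_) (hge n hn)
      · have := this.reflect
        rwa [refl_refl] at this
      · rw [← refl_shift, shift_shift]
        exact (hpos _).2
    intro n
    induction n with
    | zero => exact hbase 0 hzero
    | succ n ih =>
      by_cases hn : 0 < (b (n + 1) : ℕ)
      · exact hbase _ hn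
      · have hz : (b (n + 1) : ℕ) = 0 := by omega
        have h0 : (refl b) 0 = b (n + 1) := by
          rcases ih.upTo 1 with h | ⟨k, hk, -, h⟩
          · rw [h 0 one_pos]; simp
          · obtain rfl : k = 0 := by omega
            have : ((refl b 0 : Fin (M + 1)) : ℕ) < b (0 + (n + 1)) := h
            rw [zero_add] at this
            omega
        have h2 := lexLe_shift (n := 1) (fun i hi => by
          obtain rfl : i = 0 := by omega
          rw [h0]; simp) ih
        rw [shift_shift, add_comm 1 (n + 1), ← refl_shift] at h2
        exact hone.reflect.trans h2
  refine ⟨⟨hb, hlexle, ?_⟩, fun n => (hpos n).1⟩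
  rintro (_ | n)
  · exact (hlexge 0).trans hone
  · exact hlexge n

end Lexicographic

section Words

variable {M : ℕ} {q : ℝ} {N : ℕ} {u : Digits M}

/-- The word `u_0 … u_{N-1}` has proper suffixes bounded by its prefixes from above and strictly
bounded by the reflections of its prefixes from below. -/
structure AdmissibleWord (N : ℕ) (u : Digits M) : Prop where
  lower : ∀ i, 1 ≤ i → i < N → LtUpTo (N - i) (refl u) (shift i u)
  upper : ∀ i, 1 ≤ i → i < N → EqUpTo (N - i) (shift i u) u ∨ LtUpTo (N - i) (shift i u) u

/-- Inner shifts of a sequence starting with an admissible word and its reflection. -/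
theorem AdmissibleWord.ltUpTo_of_word (hu : AdmissibleWord N u) {y : Digits M}
    (h1 : EqUpTo N y u) (h2 : ∀ j, j + 1 < N → y (N + j) = Fin.rev (u j))
    {i : ℕ} (hi : 1 ≤ i) (hiN : i < N) :
    LtUpTo N (shift i y) u ∧ LtUpTo N (refl u) (shift i y) := by
  have hsuf : EqUpTo (N - i) (shift i y) (shift i u) := fun j hj => h1 (j + i) (by omega)
  constructor
  · rcases hu.upper i hi hiN with h | h
    · have htail : LtUpTo i (shift (N - i) (shift i y)) (shift (N - i) u) := by
        have hlow := hu.lower (N - i) (by omega) (by omega)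
        rw [Nat.sub_sub_self hiN.le] at hlow
        refine hlow.congr (fun j hj => ?_) (fun _ _ => rfl)
        rw [shift_shift, shift_apply, show j + (N - i + i) = N + j by omega, h2 j (by omega)]
        rfl
      have := EqUpTo.ltUpTo_add (m := N - i) (fun j hj => (hsuf j hj).trans (h j hj)) htail
      rwa [Nat.sub_add_cancel hiN.le] at this
    · exact (h.congr hsuf fun _ _ => rfl).mono (Nat.sub_le _ _)
  · exact ((hu.lower i hi hiN).congr (fun _ _ => rfl) hsuf).mono (Nat.sub_le _ _)

/-- Inner shifts of a sequence starting with the successor of the reflection of an admissible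
word, followed by the reflected word. -/
theorem AdmissibleWord.ltUpTo_of_reflect_succ (hu : AdmissibleWord N u) {y : Digits M}
    (h1 : ∀ j, j + 1 < N → y j = Fin.rev (u j))
    (hlast : (y (N - 1) : ℕ) = M - u (N - 1) + 1)
    (h2 : ∀ j, j + 1 < N → y (N + j) = Fin.rev (u j))
    {i : ℕ} (hi : 1 ≤ i) (hiN : i < N) :
    LtUpTo N (shift i y) u ∧ LtUpTo N (refl u) (shift i y) := by
  have hsuf : ∀ j, j + 1 < N - i → shift i y j = refl (shift i u) j :=
    fun j hj => h1 (j + i) (by omega)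
  have hend : (shift i y (N - i - 1) : ℕ) = (refl (shift i u) (N - i - 1) : ℕ) + 1 := by
    simp only [shift_apply, refl_apply, val_rev]
    rw [show N - i - 1 + i = N - 1 by omega, hlast]
  constructor
  · have hlow := (hu.lower i hi hiN).reflect
    rw [refl_refl] at hlow
    have hcase : EqUpTo (N - i) (shift i y) u ∨ LtUpTo (N - i) (shift i y) u := by
      obtain ⟨n, hn, heq, hlt⟩ := hlow
      by_cases hn' : n + 1 < N - i
      · right
        refine ⟨n, hn, fun k hk => ?_, ?_⟩
        · rw [hsuf k (by omega), heq k hk]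
        · rw [hsuf n hn']; exact hlt
      · obtain rfl : n = N - i - 1 := by omega
        have hlt' : (refl (shift i u) (N - i - 1) : ℕ) < u (N - i - 1) := hlt
        rcases (Nat.succ_le_of_lt hlt').eq_or_lt with h | h
        · left
          intro k hk
          by_cases hk' : k + 1 < N - i
          · rw [hsuf k hk', heq k (by omega)]
          · obtain rfl : k = N - i - 1 := by omega
            exact Fin.ext (by omega)
        · right
          refine ⟨N - i - 1, by omega, fun k hk => ?_, ?_⟩
          · rw [hsuf k (by omega), heq k hk]
          · rw [Fin.lt_def]; omega
    rcases hcase with h | h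
    · have htail : LtUpTo i (shift (N - i) (shift i y)) (shift (N - i) u) := by
        have hlow := hu.lower (N - i) (by omega) (by omega)
        rw [Nat.sub_sub_self hiN.le] at hlow
        refine hlow.congr (fun j hj => ?_) (fun _ _ => rfl)
        rw [shift_shift, shift_apply, show j + (N - i + i) = N + j by omega, h2 j (by omega)]
        rfl
      have := EqUpTo.ltUpTo_add h htail
      rwa [Nat.sub_add_cancel hiN.le] at this
    · exact h.mono (Nat.sub_le _ _)
  · refine LtUpTo.mono (Nat.sub_le N i) ?_
    rcases hu.upper i hi hiN with h | h
    · refine ⟨N - i - 1, by omega, fun k hk => ?_, ?_⟩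
      · rw [hsuf k (by omega), refl_apply, refl_apply, h k (by omega)]
      · rw [Fin.lt_def, hend, refl_apply, refl_apply, h _ (by omega)]
        omega
    · obtain ⟨n, hn, heq, hlt⟩ := h.reflect
      refine ⟨n, hn, fun k hk => ?_, ?_⟩
      · rw [hsuf k (by omega), heq k hk]
      · rw [Fin.lt_def] at hlt ⊢
        by_cases hn' : n + 1 < N - i
        · rw [hsuf n hn']; exact hlt
        · obtain rfl : n = N - i - 1 := by omega
          omega

/-- The periodic sequence obtained by alternating a word of length `N` with its reflection. -/
def alternating (N : ℕ) (u : Digits M) : Digits M := fun i =>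
  if (i / N) % 2 = 0 then u (i % N) else Fin.rev (u (i % N))

theorem alternating_eqUpTo (N : ℕ) (u : Digits M) : EqUpTo N (alternating N u) u := by
  intro i hi
  simp [alternating, Nat.div_eq_of_lt hi, Nat.mod_eq_of_lt hi]

theorem shift_alternating (hN : 0 < N) (u : Digits M) :
    shift N (alternating N u) = refl (alternating N u) := by
  funext i
  simp only [shift_apply, refl_apply, alternating, Nat.add_div_right i hN, Nat.add_mod_right]
  rcases Nat.mod_two_eq_zero_or_one (i / N) with h | h
  · rw [if_neg (by omega), if_pos h]
  · rw [if_pos (by omega), if_neg (by omega), Fin.rev_rev]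

theorem shift_mul_alternating (hN : 0 < N) (u : Digits M) (t : ℕ) :
    shift (N * t) (alternating N u) = alternating N u ∨
      shift (N * t) (alternating N u) = refl (alternating N u) := by
  induction t with
  | zero => exact Or.inl rfl
  | succ t ih =>
    rw [Nat.mul_succ, add_comm, ← shift_shift]
    rcases ih with h | h
    · rw [h, shift_alternating hN]; exact Or.inr rfl
    · rw [h, ← refl_shift, shift_alternating hN, refl_refl]; exact Or.inl rfl

theorem AdmissibleWord.alternating_bounds (hN : 0 < N) (hu : AdmissibleWord N u)
    (h0 : LtUpTo N (refl u) u) (n : ℕ) :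
    lexLe (shift n (alternating N u)) (alternating N u) ∧
      lexLe (refl (alternating N u)) (shift n (alternating N u)) := by
  have hpre := alternating_eqUpTo N u
  have hpre' : EqUpTo N (refl (alternating N u)) (refl u) := fun i hi => by
    rw [refl_apply, refl_apply, hpre i hi]
  have hself : lexLe (refl (alternating N u)) (alternating N u) := (h0.congr hpre' hpre).lexLt.le
  have hn : shift n (alternating N u) =
      shift (n % N) (shift (N * (n / N)) (alternating N u)) := by
    rw [shift_shift, Nat.mod_add_div]
  rw [hn]
  rcases Nat.eq_zero_or_pos (n % N) with hz | hz
  · rw [hz, shift_zero]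
    rcases shift_mul_alternating hN u (n / N) with h | h <;> rw [h]
    · exact ⟨Or.inl rfl, hself⟩
    · exact ⟨hself, Or.inl rfl⟩
  · obtain ⟨h1, h2⟩ := hu.ltUpTo_of_word hpre (fun j hj => by
      have := congrFun (shift_alternating hN u) j
      rw [shift_apply, refl_apply, hpre j (by omega)] at this
      rw [add_comm N j, this]) hz (Nat.mod_lt n hN)
    have h1' := h1.congr (fun _ _ => rfl) hpre
    have h2' := h2.congr hpre' fun _ _ => rfl
    rcases shift_mul_alternating hN u (n / N) with h | h <;> rw [h]
    · exact ⟨h1'.lexLt.le, h2'.lexLt.le⟩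
    · rw [← refl_shift]
      have h3 := h2'.reflect.lexLt.le
      rw [refl_refl] at h3
      exact ⟨h3, h1'.reflect.lexLt.le⟩

/-- The word `u` followed by the periodic repetition of the successor of its reflection. -/
def wordThenReflectSucc (N : ℕ) (u : Digits M) : Digits M := fun i =>
  if i < N then u i
  else if i % N + 1 = N then ⟨min M (M - u (N - 1) + 1), by omega⟩ else Fin.rev (u (i % N))

theorem AdmissibleWord.strict_bounds (hN : 2 ≤ N) (hu : AdmissibleWord N u)
    (h0 : LtUpTo (N - 1) (refl u) u) (n : ℕ) :
    lexLt (shift (n + 1) (wordThenReflectSucc N u)) (wordThenReflectSucc N u) ∧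
      lexLt (refl (wordThenReflectSucc N u)) (shift (n + 1) (wordThenReflectSucc N u)) := by
  set c := wordThenReflectSucc N u with hc
  have hlast : 0 < (u (N - 1) : ℕ) := by
    obtain ⟨k, hk, -, hlt⟩ := hu.lower (N - 1) (by omega) (by omega)
    obtain rfl : k = 0 := by omega
    rw [shift_apply, zero_add, Fin.lt_def] at hlt
    omega
  have hpre : EqUpTo N c u := fun i hi => by simp [hc, wordThenReflectSucc, hi]
  have hpre' : EqUpTo N (refl c) (refl u) := fun i hi => by
    rw [refl_apply, refl_apply, hpre i hi]
  have hblock : ∀ t j, j + 1 < N → c (N * (t + 1) + j) = Fin.rev (u j) := fun t j hj => by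
    have : N ≤ N * (t + 1) := Nat.le_mul_of_pos_right N (by omega)
    have hmod : (N * (t + 1) + j) % N = j := by
      rw [Nat.mul_add_mod, Nat.mod_eq_of_lt (by omega)]
    simp only [hc, wordThenReflectSucc, hmod]
    rw [if_neg (by omega), if_neg (by omega)]
  have hblock' : ∀ t, (c (N * (t + 1) + (N - 1)) : ℕ) = M - u (N - 1) + 1 := fun t => by
    have : N ≤ N * (t + 1) := Nat.le_mul_of_pos_right N (by omega)
    have hmod : (N * (t + 1) + (N - 1)) % N = N - 1 := by
      rw [Nat.mul_add_mod, Nat.mod_eq_of_lt (by omega)]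
    have := digit_le (u (N - 1))
    simp only [hc, wordThenReflectSucc, hmod]
    rw [if_neg (by omega), if_pos (by omega)]
    simp only
    omega
  suffices h : LtUpTo N (shift (n + 1) c) u ∧ LtUpTo N (refl u) (shift (n + 1) c) from
    ⟨(h.1.congr (fun _ _ => rfl) hpre).lexLt, (h.2.congr hpre' fun _ _ => rfl).lexLt⟩
  have hn : shift (n + 1) c = shift ((n + 1) % N) (shift (N * ((n + 1) / N)) c) := by
    rw [shift_shift, Nat.mod_add_div]
  rw [hn]
  have hmod : (n + 1) % N < N := Nat.mod_lt _ (by omega)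
  rcases Nat.eq_zero_or_pos ((n + 1) / N) with ht | ht
  · have hpos : 1 ≤ (n + 1) % N := by
      have := Nat.mod_add_div (n + 1) N
      rw [ht, mul_zero] at this
      omega
    rw [ht, mul_zero, shift_zero]
    exact hu.ltUpTo_of_word hpre (fun j hj => by simpa using hblock 0 j hj) hpos hmod
  · obtain ⟨t, ht⟩ : ∃ t, (n + 1) / N = t + 1 := ⟨(n + 1) / N - 1, by omega⟩
    rw [ht]
    have hy1 : ∀ j, j + 1 < N → shift (N * (t + 1)) c j = Fin.rev (u j) := fun j hj => by
      rw [shift_apply, add_comm j, hblock t j hj]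
    have hy2 : (shift (N * (t + 1)) c (N - 1) : ℕ) = M - u (N - 1) + 1 := by
      rw [shift_apply, add_comm (N - 1), hblock' t]
    rcases Nat.eq_zero_or_pos ((n + 1) % N) with hz | hz
    · rw [hz, shift_zero]
      constructor
      · exact (h0.congr (fun j hj => hy1 j (by omega)) fun _ _ => rfl).mono (Nat.sub_le _ _)
      · refine ⟨N - 1, by omega, fun j hj => (hy1 j (by omega)).symm, ?_⟩
        rw [Fin.lt_def, hy2, refl_apply, val_rev]
        omega
    · refine hu.ltUpTo_of_reflect_succ hy1 hy2 (fun j hj => ?_) hz hmod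
      rw [shift_apply, show N + j + N * (t + 1) = N * (t + 1 + 1) + j by ring, hblock _ j hj]

/-- Arbitrarily long prefixes are admissible words, if the strict lower bound is uniform. -/
theorem exists_admissibleWord {a : Digits M} (hle : ∀ n, lexLe (shift n a) a) {L : ℕ}
    (hL : ∀ n, LtUpTo L (refl a) (shift n a)) (K : ℕ) : ∃ N ≥ K, AdmissibleWord N a := by
  classical
  set P : ℕ → Prop := fun l => EqUpTo l (refl a) (shift (K + L - l) a)
  have hPL : ∀ l, P l → l < L := by
    intro l hl
    by_contra! hlL
    obtain ⟨k, hk, -, hlt⟩ := hL (K + L - l)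
    exact hlt.ne (hl k (by omega))
  set l := Nat.findGreatest P (K + L)
  have hl : P l := Nat.findGreatest_spec (P := P) (m := 0) (Nat.zero_le _)
    fun i hi => absurd hi (Nat.not_lt_zero i)
  have hlL := hPL l hl
  refine ⟨K + L - l, by omega, fun i hi hiN => ?_, fun i hi hiN => (hle i).upTo _⟩
  rcases (hL i).lexLt.le.upTo (K + L - l - i) with h | h
  swap
  · exact h
  exfalso
  set m := K + L - l - i with hm
  have hP : P (m + l) := by
    have hidx : K + L - (m + l) = i := by omega
    have hshift : shift m (shift i a) = shift (K + L - l) a := by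
      rw [shift_shift]; congr 1; omega
    have hle' : lexLe (refl a) (refl (shift m a)) := (hle m).reflect
    rcases hle'.upTo l with h' | h'
    · intro j hj
      rw [hidx]
      by_cases hjm : j < m
      · exact h j hjm
      · have e1 := hl (j - m) (by omega)
        have e2 := h' (j - m) (by omega)
        rw [← hshift] at e1
        simp only [shift_apply, refl_apply, Nat.sub_add_cancel (not_lt.1 hjm)] at e1 e2
        rw [shift_apply, refl_apply, ← e1, e2]
    · exfalso
      have hlt : LtUpTo l (shift m (shift i a)) (shift m (refl a)) := by
        rw [hshift]
        exact h'.congr (fun j hj => (hl j hj).symm) fun _ _ => rfl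
      exact (EqUpTo.ltUpTo_add (fun j hj => (h j hj).symm) hlt).not_lexLe (hL i).lexLt.le
  have := Nat.le_findGreatest (P := P) (n := K + L) (m := m + l) (by omega) hP
  omega

/-- An expansion of `1` all of whose shifts lie strictly above its reflection belongs to a base
in the closure of the univoque bases. -/
theorem Admissible.mem_closure (hq : 1 < q) (hqM : q < M + 1) {a : Digits M}
    (ha : Admissible M q a) (hne : ∀ h, shift (h + 1) a ≠ refl a) :
    q ∈ closure (Ubases M 1) := by
  have hgt : ∀ n, lexLt (refl a) (shift (n + 1) a) := fun n =>
    (ha.ge _).lt_of_ne (hne n).symm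
  by_cases hper : ∃ m, shift (m + 1) a = a
  swap
  · push Not at hper
    exact subset_closure (mem_Ubases_one hq hqM.le ha.value
      (fun n => (ha.le _).lt_of_ne (hper n)) hgt)
  obtain ⟨m, hm⟩ := hper
  have hgt' : ∀ n, ∃ L, LtUpTo L (refl a) (shift n a) := by
    have : ∀ n, lexLt (refl a) (shift n a) := by
      rintro (_ | n)
      · have := hgt m
        rwa [hm] at this
      · exact hgt n
    intro n
    obtain ⟨k, hk⟩ := this n
    exact ⟨k + 1, k, by omega, hk⟩
  choose f hf using hgt'
  have hperiod : ∀ t, shift ((m + 1) * t) a = a := by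
    intro t
    induction t with
    | zero => rfl
    | succ t ih => rw [Nat.mul_succ, add_comm, ← shift_shift, ih, hm]
  have hL : ∀ n, LtUpTo ((Finset.range (m + 1)).sup f) (refl a) (shift n a) := by
    intro n
    have hn : shift n a = shift (n % (m + 1)) a := by
      conv_lhs => rw [← Nat.mod_add_div n (m + 1), ← shift_shift, hperiod]
    rw [hn]
    exact (hf _).mono (Finset.le_sup (f := f)
      (Finset.mem_range.2 (Nat.mod_lt n (Nat.succ_pos m))))
  set L := (Finset.range (m + 1)).sup f
  have hseq : ∀ K, ∃ c : Digits M, EqUpTo K c a ∧ ∀ n, lexLt (shift (n + 1) c) c ∧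
      lexLt (refl c) (shift (n + 1) c) := by
    intro K
    obtain ⟨N, hN, hw⟩ := exists_admissibleWord ha.le hL (K + L + 2)
    refine ⟨wordThenReflectSucc N a, fun i hi => ?_,
      hw.strict_bounds (by omega) ((hL 0).mono (by omega))⟩
    have : i < N := by omega
    simp [wordThenReflectSucc, this]
  choose c hca hc using hseq
  have hlim : Filter.Tendsto c Filter.atTop (nhds a) := by
    rw [tendsto_pi_nhds]
    intro i
    refine tendsto_const_nhds.congr' ?_
    filter_upwards [Filter.eventually_gt_atTop i] with K hK
    exact (hca K i hK).symm
  rw [Metric.mem_closure_iff]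
  intro ε hε
  obtain ⟨η, hη0, hη⟩ := exists_between
    (show 0 < min ε (min (q - 1) (M + 1 - q)) from
      lt_min hε (lt_min (by linarith) (by linarith)))
  rw [lt_min_iff, lt_min_iff] at hη
  obtain ⟨hη1, hη2, hη3⟩ := hη
  have hlow : 1 < piQ M (q - η) a := by
    rw [← ha.value]
    refine piQ_lt_of_lt (by linarith) (by linarith) ?_
    have := piQ_antitone (q := q - η) (r := q) (by linarith) (by linarith) a
    rw [ha.value] at this
    linarith
  have hhigh : piQ M (q + η) a < 1 := by
    rw [← ha.value]
    exact piQ_lt_of_lt hq (by linarith) (by rw [ha.value]; exact one_pos)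
  have e1 := (((continuous_piQ (M := M) (q := q - η) (by linarith)).tendsto a).comp
    hlim).eventually (lt_mem_nhds hlow)
  have e2 := (((continuous_piQ (M := M) (q := q + η) (by linarith)).tendsto a).comp
    hlim).eventually (gt_mem_nhds hhigh)
  obtain ⟨K, hK1, hK2⟩ := (e1.and e2).exists
  have hcont : ContinuousOn (fun r => piQ M r (c K)) (Set.Icc (q - η) (q + η)) :=
    (continuousOn_piQ_base (c K)).mono fun r hr => by
      have := hr.1
      simp only [Set.mem_Ioi]
      linarith
  obtain ⟨r, hr, hr1⟩ := intermediate_value_Icc' (by linarith) hcont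
    (show (1 : ℝ) ∈ Set.Icc _ _ from ⟨le_of_lt hK2, le_of_lt hK1⟩)
  refine ⟨r, mem_Ubases_one (by linarith [hr.1]) (by linarith [hr.2]) hr1
    (fun n => (hc K n).1) fun n => (hc K n).2, ?_⟩
  rw [Real.dist_eq, abs_lt]
  constructor <;> linarith [hr.1, hr.2]

end Words

section Bifurcation

variable {M : ℕ} {q r : ℝ}

/-- A base of `𝒱` other than `M + 1` has an admissible expansion of `1`. -/
theorem exists_admissible_of_mem_Vset (hq : q ∈ Vset M) (hqM : q < M + 1) :
    ∃ a : Digits M, Admissible M q a ∧ ∀ n, 0 < piQ M q (shift n a) := by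
  have hq1 : 1 < q := hq.1.1
  let F : Set.Ioc q ((M : ℝ) + 1) → Set (Digits M) := fun r =>
    {e | 1 ≤ piQ M q e ∧ piQ M r e ≤ 1 ∧
      (∀ n, e n = Fin.last M ∨ piQ M r (shift (n + 1) e) ≤ 1) ∧
      ∀ n, e n = 0 ∨ piQ M r (refl (shift (n + 1) e)) ≤ 1}
  have hr1 : ∀ r : Set.Ioc q ((M : ℝ) + 1), 1 < (r : ℝ) := fun r => hq1.trans r.2.1
  have hclosed : ∀ r, IsClosed (F r) := by
    intro r
    have hc := continuous_piQ (M := M) (hr1 r)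
    have hor : ∀ (i : Fin (M + 1)) (g : ℕ → Digits M → Digits M), (∀ n, Continuous (g n)) →
        IsClosed {e : Digits M | ∀ n, e n = i ∨ piQ M r (g n e) ≤ 1} := by
      intro i g hg
      rw [Set.ofPred_forall]
      refine isClosed_iInter fun n => ?_
      rw [Set.ofPred_or]
      exact (isClosed_eq (continuous_apply n) continuous_const).union
        (isClosed_le (hc.comp (hg n)) continuous_const)
    exact (isClosed_le continuous_const (continuous_piQ hq1)).inter
      ((isClosed_le hc continuous_const).inter
        ((hor _ _ fun n => continuous_shift (n + 1)).inter
          (hor _ _ fun n => continuous_refl.comp (continuous_shift (n + 1)))))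
  have hmono : ∀ r s : Set.Ioc q ((M : ℝ) + 1), (r : ℝ) ≤ s → F r ⊆ F s := by
    rintro r s hrs e ⟨h1, h2, h3, h4⟩
    exact ⟨h1, (piQ_antitone (hr1 r) hrs _).trans h2,
      fun n => (h3 n).imp_right (piQ_antitone (hr1 r) hrs _).trans,
      fun n => (h4 n).imp_right (piQ_antitone (hr1 r) hrs _).trans⟩
  have hne : ∀ r, (F r).Nonempty := by
    intro r
    have hin : ∀ d ∈ UqSym M (r : ℝ), ∀ n, (d n : ℕ) < M → 1 ≤ piQ M q (shift (n + 1) d) →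
        shift (n + 1) d ∈ F r := by
      intro d hd n hn hle
      have h := (mem_UqSym_iff (hr1 r) r.2.2 d).1 hd
      refine ⟨hle, ((h n).1 hn).le, fun k => ?_, fun k => ?_⟩
      · rw [or_iff_not_imp_left, shift_shift, add_right_comm]
        intro hk
        refine ((h (k + (n + 1))).1 ?_).le
        have : (d (k + (n + 1)) : ℕ) ≠ M := fun h => hk (Fin.ext h)
        have := digit_le (d (k + (n + 1)))
        omega
      · rw [or_iff_not_imp_left, shift_shift, add_right_comm]
        intro hk
        refine ((h (k + (n + 1))).2 ?_).le
        have : (d (k + (n + 1)) : ℕ) ≠ 0 := fun h => hk (Fin.ext h)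
        omega
    have hdiff : ¬ UqSym M (r : ℝ) ⊆ UqSym M q := fun hsub =>
      hq.2 r ⟨hr1 r, r.2.2⟩ r.2.1 (hsub.antisymm (UqSym_mono hq1 r.2.1.le r.2.2))
    obtain ⟨d, hd, hdq⟩ := Set.not_subset.1 hdiff
    rw [mem_UqSym_iff hq1 hqM.le] at hdq
    push Not at hdq
    obtain ⟨n, hn⟩ := hdq
    by_cases h1 : (d n : ℕ) < M ∧ 1 ≤ piQ M q (shift (n + 1) d)
    · exact ⟨_, hin d hd n h1.1 h1.2⟩
    · obtain ⟨h2, h3⟩ := hn fun h => not_le.1 fun h' => h1 ⟨h, h'⟩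
      refine ⟨_, hin (refl d) (refl_mem_UqSym (hr1 r) hd) n ?_ h3⟩
      rw [refl_apply, val_rev]
      omega
  have : Nonempty (Set.Ioc q ((M : ℝ) + 1)) := ⟨⟨M + 1, hqM, le_rfl⟩⟩
  obtain ⟨a, ha⟩ := IsCompact.nonempty_iInter_of_directed_nonempty_isCompact_isClosed F
    (fun r s => by
      rcases le_total (r : ℝ) s with h | h
      · exact ⟨r, subset_rfl, hmono r s h⟩
      · exact ⟨s, hmono s r h, subset_rfl⟩) hne (fun r => (hclosed r).isCompact) hclosed
  rw [Set.mem_iInter] at ha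
  have hlim : ∀ e : Digits M, (∀ r : Set.Ioc q ((M : ℝ) + 1), piQ M r e ≤ 1) → piQ M q e ≤ 1 := by
    intro e he
    have hc : Filter.Tendsto (fun r => piQ M r e) (nhdsWithin q (Set.Ioi q))
        (nhds (piQ M q e)) :=
      ((continuousOn_piQ_base e).continuousAt (Ioi_mem_nhds hq1)).tendsto.mono_left
        nhdsWithin_le_nhds
    refine le_of_tendsto hc ?_
    filter_upwards [Ioc_mem_nhdsGT hqM] with r hr
    exact he ⟨r, hr⟩
  refine ⟨a, admissible_of_values hq1 hqM
    (le_antisymm (hlim a fun r => (ha r).2.1) (ha ⟨M + 1, hqM, le_rfl⟩).1)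
    (fun n hn => hlim _ fun r => ((ha r).2.2.1 n).resolve_left fun h => ?_)
    (fun n hn => hlim _ fun r => ((ha r).2.2.2 n).resolve_left fun h => ?_)⟩
  · rw [h] at hn
    simp at hn
  · rw [h] at hn
    simp at hn

theorem piQ_lt_one_of_le_one (hq : 1 < q) (hqr : q < r) {d : Digits M} (hd : piQ M q d ≤ 1) :
    piQ M r d < 1 := by
  rcases (piQ_nonneg hq d).eq_or_lt with h | h
  · have := piQ_antitone hq hqr.le d
    linarith
  · exact (piQ_lt_of_lt hq hqr h).trans_le hd

/-- An admissible expansion of `1` that alternates a word with its reflection belongs to a base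
in `𝒱`. -/
theorem Admissible.mem_Vset (hq : 1 < q) (hqM : q ≤ M + 1) {b : Digits M}
    (hb : Admissible M q b) {N : ℕ} (hN : shift (N + 1) b = refl b) (hlast : 0 < (b N : ℕ)) :
    q ∈ Vset M := by
  refine ⟨⟨hq, hqM⟩, fun r hr hqr heq => ?_⟩
  have hmem : b ∈ UqSym M r := (mem_UqSym_iff hr.1 hr.2 b).2 fun n =>
    ⟨fun _ => piQ_lt_one_of_le_one hq hqr (hb.piQ_shift_le hq _),
      fun _ => piQ_lt_one_of_le_one hq hqr (hb.piQ_refl_shift_le hq _)⟩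
  rw [heq, mem_UqSym_iff hq hqM] at hmem
  have hlt := (hmem N).2 hlast
  rw [hN, refl_refl, hb.value] at hlt
  exact lt_irrefl _ hlt

/-- The word of length `m` obtained from a sequence by increasing its digit at `m - 1`. -/
def succLast (m : ℕ) (a : Digits M) : Digits M := fun i =>
  if i + 1 = m then ⟨min M (a i + 1), by omega⟩ else a i

/-- The base following a base with periodic admissible expansion of `1`: it lies in `𝒱`, and its
unique expansions have tails bounded by that expansion. -/
theorem Admissible.exists_next (hM : 0 < M) (hq : 1 < q) (hqM : q < M + 1) {a : Digits M}
    (ha : Admissible M q a) (hper : ∃ m, 0 < m ∧ shift m a = a) :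
    ∃ s ∈ Vset M, q < s ∧ ∀ d ∈ UqSym M s, ∀ n, (d n : ℕ) < M →
      lexLe (shift (n + 1) d) a := by
  classical
  have hmin : ∀ i < Nat.find hper, 0 < i → shift i a ≠ a := fun i hi h0 h =>
    Nat.find_min hper hi ⟨h0, h⟩
  obtain ⟨hm0, hm⟩ := Nat.find_spec hper
  set m := Nat.find hper
  have hlast : (a (m - 1) : ℕ) < M := by
    by_contra! hge
    have hM' : (a (m - 1) : ℕ) = M := le_antisymm (digit_le _) hge
    have h1 := ha.piQ_shift_le hq (m - 1)
    rw [piQ_cons hq, shift_shift, Nat.add_sub_cancel' hm0, hm, ha.value, shift_apply, zero_add,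
      hM', div_le_one (by linarith)] at h1
    linarith
  set w := succLast m a with hw
  have hwlt : ∀ i, i + 1 < m → w i = a i := fun i hi => by
    simp only [hw, succLast]
    rw [if_neg (by omega)]
  have hwlast : (w (m - 1) : ℕ) = a (m - 1) + 1 := by
    simp only [hw, succLast]
    rw [if_pos (by omega)]
    simp only
    omega
  have hword : AdmissibleWord m w := by
    have hsuf : ∀ i j, j + i + 1 < m → shift i w j = shift i a j := fun i j hj => hwlt _ hj
    have hend : ∀ i, i < m → (shift i w (m - i - 1) : ℕ) = (shift i a (m - i - 1) : ℕ) + 1 := by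
      intro i hi
      simp only [shift_apply, show m - i - 1 + i = m - 1 by omega, hwlast]
    constructor
    · intro i hi him
      have hr : ∀ j < m - i, refl w j = refl a j := fun j hj => by
        rw [refl_apply, refl_apply, hwlt j (by omega)]
      rcases (ha.ge i).upTo (m - i) with h | ⟨n, hn, heq, hlt⟩
      · refine ⟨m - i - 1, by omega, fun j hj => ?_, ?_⟩
        · rw [hr j (by omega), h j (by omega), hsuf i j (by omega)]
        · rw [Fin.lt_def, hend i him, hr _ (by omega), h _ (by omega)]
          omega
      · refine ⟨n, hn, fun j hj => ?_, ?_⟩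
        · rw [hr j (by omega), heq j hj, hsuf i j (by omega)]
        · rw [Fin.lt_def] at hlt ⊢
          rw [hr n hn]
          by_cases hn' : n + i + 1 < m
          · rw [hsuf i n hn']; exact hlt
          · obtain rfl : n = m - i - 1 := by omega
            rw [hend i him]; omega
    · intro i hi him
      have hr : ∀ j < m - i, w j = a j := fun j hj => hwlt j (by omega)
      rcases (ha.le i).upTo (m - i) with h | ⟨n, hn, heq, hlt⟩
      · exfalso
        refine hmin i him hi ((ha.le i).antisymm (lexLe_of_shift
          (fun j hj => (h j hj).symm) ?_))
        rw [shift_shift, Nat.sub_add_cancel him.le, hm]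
        exact ha.le _
      · rw [Fin.lt_def] at hlt
        by_cases hn' : n + i + 1 < m
        · right
          refine ⟨n, hn, fun j hj => ?_, ?_⟩
          · rw [hr j (by omega), hsuf i j (by omega), heq j hj]
          · rw [Fin.lt_def, hr n hn, hsuf i n hn']; exact hlt
        · obtain rfl : n = m - i - 1 := by omega
          have he := hend i him
          rcases (Nat.succ_le_of_lt hlt).eq_or_lt with h | h
          · left
            intro j hj
            by_cases hj' : j + i + 1 < m
            · rw [hr j hj, hsuf i j hj', heq j (by omega)]
            · obtain rfl : j = m - i - 1 := by omega
              rw [hr _ hj]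
              exact Fin.ext (by omega)
          · right
            refine ⟨m - i - 1, hn, fun j hj => ?_, ?_⟩
            · rw [hr j (by omega), hsuf i j (by omega), heq j hj]
            · rw [Fin.lt_def, hr _ hn]; omega
  have hself : LtUpTo m (refl w) w := by
    have hr : ∀ j, j + 1 < m → refl w j = refl a j := fun j hj => by
      rw [refl_apply, refl_apply, hwlt j hj]
    have hrl : (refl w (m - 1) : ℕ) < refl a (m - 1) := by
      simp only [refl_apply, val_rev]; omega
    rcases (ha.ge 0).upTo m with h | ⟨n, hn, heq, hlt⟩
    · refine ⟨m - 1, by omega, fun j hj => ?_, ?_⟩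
      · rw [hr j (by omega), h j (by omega), shift_zero, hwlt j (by omega)]
      · have := h (m - 1) (by omega)
        rw [shift_zero] at this
        rw [this] at hrl
        rw [Fin.lt_def]; omega
    · refine ⟨n, hn, fun j hj => ?_, ?_⟩
      · rw [hr j (by omega), heq j hj, shift_zero, hwlt j (by omega)]
      · rw [Fin.lt_def] at hlt ⊢
        rw [shift_zero] at hlt
        by_cases hn' : n + 1 < m
        · rw [hr n hn', hwlt n hn']; exact hlt
        · obtain rfl : n = m - 1 := by omega
          omega
  set b := alternating m w with hbdef
  have hbw : EqUpTo m b w := alternating_eqUpTo m w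
  have hbm : shift m b = refl b := shift_alternating hm0 w
  have hbounds := hword.alternating_bounds hm0 hself
  have hblt : ∀ i, i + 1 < m → b i = a i := fun i hi => (hbw i (by omega)).trans (hwlt i hi)
  have hblast : (b (m - 1) : ℕ) = a (m - 1) + 1 := by rw [hbw _ (by omega), hwlast]
  have hab : lexLt a b := ⟨m - 1, fun i hi => (hblt i (by omega)).symm, by
    rw [Fin.lt_def, hblast]; omega⟩
  have hq1 : 1 < piQ M q b := by
    obtain ⟨n, hn⟩ := one_add_le_piQ_of_lexLt hq ha.value
      (fun j _ => ha.piQ_shift_le hq _) hab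
    have hpos : 0 < piQ M q (shift n b) := by
      rcases Nat.eq_zero_or_pos (b n : ℕ) with h | h
      · refine piQ_pos hq (i := m) ?_
        have := congrFun hbm n
        rw [shift_apply, refl_apply] at this
        rw [shift_apply, add_comm m n, this, val_rev, h]
        exact hM
      · exact piQ_pos hq (i := 0) (by simpa using h)
    have : 0 < piQ M q (shift n b) / q ^ n := by positivity
    linarith
  have hM1 : piQ M ((M : ℝ) + 1) b ≤ 1 := by
    have hMr : (0 : ℝ) < M := by exact_mod_cast hM
    have := piQ_le (q := (M : ℝ) + 1) (by linarith) b
    rwa [add_sub_cancel_right, div_self hMr.ne'] at this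
  obtain ⟨s, ⟨hqs, hsM⟩, hs⟩ := intermediate_value_Icc' hqM.le
    ((continuousOn_piQ_base b).mono fun r hr => hq.trans_le hr.1) ⟨hM1, hq1.le⟩
  have hs1 : 1 < s := hq.trans_le hqs
  have hqs' : q < s := hqs.lt_of_ne fun h => by
    rw [← h] at hs
    exact hq1.ne' hs
  have hb : Admissible M s b := ⟨hs, fun n => (hbounds n).1, fun n => (hbounds n).2⟩
  refine ⟨s, hb.mem_Vset hs1 hsM (N := m - 1) (by rwa [Nat.sub_add_cancel hm0]) (by omega),
    hqs', fun d hd n hn => ?_⟩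
  have hagree : ∀ k n, (d n : ℕ) < M → lexLe a (shift (n + 1) d) →
      EqUpTo (m * k) (shift (n + 1) d) a := by
    intro k
    induction k with
    | zero => intro n _ _ i hi; omega
    | succ k ih =>
      intro n hn hle
      have hlt := hb.lexLt_of_mem hs1 hsM hd hn
      have hEq : EqUpTo m (shift (n + 1) d) a := by
        rcases hle.upTo m with h | ⟨j, hj, heq, hjlt⟩
        · exact fun i hi => (h i hi).symm
        exfalso
        have hfirst : EqUpTo m b (shift (n + 1) d) := by
          obtain ⟨k, hk, hklt⟩ := hlt
          rw [Fin.lt_def] at hjlt hklt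
          have hjk : j < k := by
            by_contra! hkj
            have hle' : (a k : ℕ) ≤ (shift (n + 1) d k : ℕ) := by
              rcases hkj.eq_or_lt with h | h
              · rw [h]; exact hjlt.le
              · rw [heq k h]
            have hk1 : k + 1 = m := by
              by_contra hne
              rw [hblt k (by omega)] at hklt
              omega
            obtain rfl : k = m - 1 := by omega
            obtain rfl : j = m - 1 := by omega
            omega
          have hj1 : j + 1 = m := by
            by_contra hne
            rw [hk j hjk, hblt j (by omega)] at hjlt
            omega
          exact fun i hi => (hk i (by omega)).symm
        have hdig : 0 < (d (n + m) : ℕ) := by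
          have := hfirst (m - 1) (by omega)
          rw [shift_apply, show m - 1 + (n + 1) = n + m by omega] at this
          rw [← this]; omega
        have hr := hb.lexLt_of_mem hs1 hsM (refl_mem_UqSym hs1 hd) (n := n + m) (by
          rw [refl_apply, val_rev]; omega)
        have hr' := hr.reflect
        rw [refl_shift, refl_refl, ← hbm, show n + m + 1 = m + (n + 1) by omega,
          ← shift_shift] at hr'
        exact not_lexLt.2 hlt.le (lexLt_of_shift hfirst hr')
      have hdig : (d (n + m) : ℕ) < M := by
        have := hEq (m - 1) (by omega)
        rw [shift_apply, show m - 1 + (n + 1) = n + m by omega] at this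
        rw [this]; exact hlast
      have hle' := lexLe_shift (fun i hi => (hEq i hi).symm) hle
      rw [hm, shift_shift, show m + (n + 1) = n + m + 1 by omega] at hle'
      have hrec := ih (n + m) hdig hle'
      intro i hi
      by_cases him : i < m
      · exact hEq i him
      · have h1 := hrec (i - m) (by rw [Nat.mul_succ] at hi; omega)
        have h2 := congrFun hm (i - m)
        rw [shift_apply] at h1 h2 ⊢
        rw [Nat.sub_add_cancel (not_lt.1 him)] at h2
        rw [← h2] at h1
        rwa [show i + (n + 1) = i - m + (n + m + 1) by omega]
  by_contra hnle
  have hlt := not_lexLe.1 hnle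
  refine hlt.ne (funext fun i => (hagree (i + 1) n hn hlt.le i ?_).symm)
  calc i < i + 1 := Nat.lt_succ_self i
    _ ≤ m * (i + 1) := Nat.le_mul_of_pos_left _ hm0

end Bifurcation

section Isolation

variable {M : ℕ} {q r s p : ℝ} {a d e : Digits M}

/-- A unique expansion is determined by a prefix containing a digit below `M`, if it is followed
by a sequence `a` bounding all tails and such that `a` contains its own reflection. -/
theorem exists_eqUpTo_imp_eq {h : ℕ} (hrefl : shift (h + 1) a = refl a) (ha : 0 < (a h : ℕ))
    {S : Set (Digits M)}
    (hS : ∀ e ∈ S, ∀ n, ((e n : ℕ) < M → lexLe (shift (n + 1) e) a) ∧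
      (0 < (e n : ℕ) → lexLe (refl (shift (n + 1) e)) a))
    {k : ℕ} (hk : (d k : ℕ) < M) (hd : shift (k + 1) d = a) :
    ∃ K, ∀ e ∈ S, EqUpTo K e d → e = d := by
  refine ⟨k + 1 + (h + 1), fun e he hed => ?_⟩
  have hda : ∀ i, d (i + (k + 1)) = a i := fun i => congrFun hd i
  have hle : lexLe (shift (k + 1) e) a := ((hS e he k).1 (by rwa [hed k (by omega)]))
  have hge : lexLe a (shift (k + 1) e) := by
    refine lexLe_of_shift (n := h + 1) (fun i hi => ?_) ?_
    · rw [shift_apply, hed _ (by omega), hda]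
    · have hdig : 0 < (e (h + (k + 1)) : ℕ) := by rwa [hed _ (by omega), hda]
      have := ((hS e he (h + (k + 1))).2 hdig).reflect
      rwa [shift_shift, hrefl, show h + 1 + (k + 1) = h + (k + 1) + 1 by omega,
        ← refl_refl (shift _ e)]
  refine eq_of_shift (n := k + 1) (fun i hi => hed i (by omega)) ?_
  rw [hd, hle.antisymm hge]

/-- A sequence whose tails are bounded by an expansion of `1` in base `q` is a unique expansion in
every larger base. -/
theorem mem_UqSym_of_tails (hq : 1 < q) (hqr : q < r) (hrM : r ≤ M + 1) (ha : piQ M q a = 1)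
    (hd : ∀ n, ((d n : ℕ) < M → lexLe (shift (n + 1) d) a) ∧
      (0 < (d n : ℕ) → lexLe (refl (shift (n + 1) d)) a)) : d ∈ UqSym M r := by
  refine (mem_UqSym_iff (hq.trans hqr) hrM d).2 fun n => ⟨fun hn => piQ_lt_one_of_le_one hq hqr ?_,
    fun hn => piQ_lt_one_of_le_one hq hqr ?_⟩
  · refine piQ_le_one_of_lexLe hq ha ((hd n).1 hn) fun j hj => ?_
    have := (hd (j + (n + 1))).1 hj
    rwa [shift_shift, add_right_comm]
  · refine piQ_le_one_of_lexLe hq ha ((hd n).2 hn) fun j hj => ?_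
    rw [refl_apply, val_rev] at hj
    have := (hd (j + (n + 1))).2 (by rw [shift_apply] at hj; omega)
    rwa [← refl_shift, shift_shift, add_right_comm]

/-- A sequence whose tails are bounded by a quasi-greedy expansion `a` of `1` in base `q`, and
which is not a unique expansion in base `q`, has `a` or its reflection as a tail. -/
theorem exists_tail_eq (hq : 1 < q) (hqM : q ≤ M + 1) (ha : piQ M q a = 1)
    (hpos : ∀ n, 0 < piQ M q (shift n a))
    (hd : ∀ n, ((d n : ℕ) < M → lexLe (shift (n + 1) d) a) ∧
      (0 < (d n : ℕ) → lexLe (refl (shift (n + 1) d)) a)) (hdq : d ∉ UqSym M q) :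
    ∃ k, ((d k : ℕ) < M ∧ shift (k + 1) d = a) ∨
      (0 < (d k : ℕ) ∧ refl (shift (k + 1) d) = a) := by
  by_contra! hne
  refine hdq ((mem_UqSym_iff hq hqM d).2 fun n => ⟨fun hn => ?_, fun hn => ?_⟩)
  · refine piQ_lt_one_of_lexLt hq ha hpos (((hd n).1 hn).lt_of_ne ((hne n).1 hn)) fun j hj => ?_
    have := (hd (j + (n + 1))).1 hj
    rwa [shift_shift, add_right_comm]
  · refine piQ_lt_one_of_lexLt hq ha hpos (((hd n).2 hn).lt_of_ne ((hne n).2 hn)) fun j hj => ?_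
    rw [refl_apply, val_rev] at hj
    have := (hd (j + (n + 1))).2 (by rw [shift_apply] at hj; omega)
    rwa [← refl_shift, shift_shift, add_right_comm]

theorem isOpen_eqUpTo (K : ℕ) (d : Digits M) : IsOpen {e : Digits M | EqUpTo K e d} := by
  have : {e : Digits M | EqUpTo K e d} = ⋂ i ∈ Set.Iio K, (fun e : Digits M => e i) ⁻¹' {d i} := by
    ext e
    simp [EqUpTo]
  rw [this]
  exact (Set.finite_Iio K).isOpen_biInter fun i _ =>
    (isOpen_discrete {d i}).preimage (continuous_apply i)

/-- Expansions of the same number in nearby bases share a long prefix with its unique expansion. -/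
theorem exists_eqUpTo_of_near (hp : 1 < p) (hd : d ∈ UqSym M p) (K : ℕ) :
    ∃ ε > 0, ∀ r, |r - p| < ε → ∀ e : Digits M, piQ M r e = piQ M p d → EqUpTo K e d := by
  set I := Set.Icc ((1 + p) / 2) (p + 1) with hI
  have hI1 : ∀ r ∈ I, 1 < r := fun r hr => by have := hr.1; linarith
  have hIp : I ∈ nhds p := Icc_mem_nhds (by linarith) (by linarith)
  set C : Set (ℝ × Digits M) := I ×ˢ {e | ¬ EqUpTo K e d} with hC
  have hCc : IsCompact C :=
    isCompact_Icc.prod (isOpen_eqUpTo K d).isClosed_compl.isCompact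
  have hD : IsCompact (C ∩ (fun z : ℝ × Digits M => piQ M z.1 z.2) ⁻¹' {piQ M p d}) :=
    hCc.of_isClosed_subset ((continuousOn_piQ.mono fun z hz =>
      ⟨hI1 _ hz.1, trivial⟩).preimage_isClosed_of_isClosed hCc.isClosed isClosed_singleton)
      Set.inter_subset_left
  have hcl := (hD.image continuous_fst).isClosed
  have hnot : p ∈ (Prod.fst '' (C ∩ (fun z : ℝ × Digits M => piQ M z.1 z.2) ⁻¹' {piQ M p d}))ᶜ := by
    rintro ⟨⟨r, e⟩, ⟨hz, hv⟩, rfl⟩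
    obtain rfl := hd e hv
    exact hz.2 fun _ _ => rfl
  obtain ⟨ε, hε, hball⟩ := Metric.mem_nhds_iff.1
    (Filter.inter_mem hIp (hcl.isOpen_compl.mem_nhds hnot))
  refine ⟨ε, hε, fun r hr e he => ?_⟩
  obtain ⟨h1, h2⟩ := hball (show r ∈ Metric.ball p ε from hr)
  by_contra hne
  exact h2 ⟨(r, e), ⟨⟨h1, hne⟩, he⟩, rfl⟩

/-- If a unique expansion is determined by a prefix among all unique expansions in bases close to
`p`, then `p` is isolated among the univoque bases of its value. -/
theorem isolated_of_eqUpTo (hp : 1 < p) (hps : p < s) (hsM : s ≤ M + 1) (hd : d ∈ UqSym M p)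
    (hpos : 0 < piQ M p d) {K : ℕ} (hK : ∀ e ∈ UqSym M s, EqUpTo K e d → e = d) :
    p ∈ Ubases M (piQ M p d) ∧
      ∃ ε > 0, Ubases M (piQ M p d) ∩ Set.Ioo (p - ε) (p + ε) = {p} := by
  have hmem : p ∈ Ubases M (piQ M p d) := ⟨⟨hp, hps.le.trans hsM⟩, d, rfl, hd⟩
  refine ⟨hmem, ?_⟩
  obtain ⟨ε, hε, hnear⟩ := exists_eqUpTo_of_near hp hd K
  refine ⟨min ε (s - p), lt_min hε (by linarith), Set.eq_singleton_iff_unique_mem.2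
    ⟨⟨hmem, ?_⟩, ?_⟩⟩
  · have : 0 < min ε (s - p) := lt_min hε (by linarith)
    exact ⟨by linarith, by linarith⟩
  · rintro r ⟨⟨hr, e, he, hu⟩, hr1, hr2⟩
    have hmin1 := min_le_left ε (s - p)
    have hmin2 := min_le_right ε (s - p)
    have heU : e ∈ UqSym M r := fun c hc => hu c (hc.trans he)
    have hes := UqSym_mono hr.1 (show r ≤ s by linarith) hsM heU
    obtain rfl := hK e hes
      (hnear r (abs_lt.2 ⟨by linarith, by linarith⟩) e he)
    rcases lt_trichotomy r p with h | h | h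
    · exact absurd he (piQ_lt_of_lt hr.1 h (he ▸ hpos)).ne'
    · exact h
    · exact absurd he (piQ_lt_of_lt hp h hpos).ne

end Isolation

/-- Proposition: let `(q₀, q₀*)` be a connected component of `(1, M+1] \ cl(𝒰)` and let
`q < q'` be consecutive elements of `𝒱` inside it. If `p ∈ (q, q')`, `(d_i) ∈ 𝐔_{q'} \ 𝐔_q`
and `x = π_p((d_i)) > 0`, then `p` is an isolated point of `𝒰(x)`. -/
theorem isolated_point_of_Ubases (M : ℕ) (hM : 0 < M) (q₀ q₀s : ℝ) (hlt₀ : q₀ < q₀s)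
    (hcomp : Set.Ioo q₀ q₀s ⊆ Set.Ioc (1 : ℝ) ((M : ℝ) + 1) \ closure (Ubases M 1))
    (hq₀ : q₀ ∉ Set.Ioc (1 : ℝ) ((M : ℝ) + 1) \ closure (Ubases M 1))
    (hq₀s : q₀s ∉ Set.Ioc (1 : ℝ) ((M : ℝ) + 1) \ closure (Ubases M 1))
    (q q' : ℝ) (hq : q ∈ Vset M ∩ Set.Ioo q₀ q₀s) (hq' : q' ∈ Vset M ∩ Set.Ioo q₀ q₀s)
    (hqq' : q < q') (hcons : Set.Ioo q q' ∩ Vset M = ∅)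
    (p : ℝ) (hp : p ∈ Set.Ioo q q')
    (d : Digits M) (hd : d ∈ UqSym M q' \ UqSym M q)
    (x : ℝ) (hxd : x = piQ M p d) (hxpos : 0 < x) :
    p ∈ Ubases M x ∧ ∃ ε > 0, Ubases M x ∩ Set.Ioo (p - ε) (p + ε) = {p} := by
  obtain ⟨hqV, hq0⟩ := hq
  have hq1 : 1 < q := hqV.1.1
  have hqM : q < M + 1 := hqq'.trans_le hq'.1.1.2
  have hp1 : 1 < p := hq1.trans hp.1
  obtain ⟨a, ha, hpos⟩ := exists_admissible_of_mem_Vset hqV hqM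
  obtain ⟨h, hrefl⟩ : ∃ h, shift (h + 1) a = refl a := by
    by_contra! hne
    exact (hcomp hq0).2 (ha.mem_closure hq1 hqM hne)
  have hper : shift (h + 1 + (h + 1)) a = a := by
    rw [← shift_shift, hrefl, ← refl_shift, hrefl, refl_refl]
  obtain ⟨s, hsV, hqs, hs⟩ := ha.exists_next hM hq1 hqM ⟨_, by omega, hper⟩
  have hs1 : 1 < s := hsV.1.1
  have hq's : q' ≤ s := by
    by_contra! hlt
    exact (Set.mem_empty_iff_false s).1 (hcons ▸ ⟨⟨hqs, hlt⟩, hsV⟩)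
  have hps : p < s := hp.2.trans_le hq's
  have hS : ∀ e ∈ UqSym M s, ∀ n, ((e n : ℕ) < M → lexLe (shift (n + 1) e) a) ∧
      (0 < (e n : ℕ) → lexLe (refl (shift (n + 1) e)) a) := fun e he n =>
    ⟨hs e he n, fun hn => hs _ (refl_mem_UqSym hs1 he) n (by
      rw [refl_apply, val_rev]; have := digit_le (e n); omega)⟩
  have hah : 0 < (a h : ℕ) := by
    by_contra! hle
    have h1 := ha.piQ_refl_shift_le hq1 h
    rw [piQ_cons hq1, refl_apply, val_rev, shift_apply, zero_add, ← refl_shift, shift_shift,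
      add_comm 1 h, hrefl, refl_refl, ha.value, Nat.le_zero.1 hle, Nat.sub_zero,
      div_le_one (by linarith)] at h1
    linarith
  have hds : d ∈ UqSym M s := UqSym_mono (hq1.trans hqq') hq's hsV.1.2 hd.1
  have hdp : d ∈ UqSym M p :=
    mem_UqSym_of_tails hq1 hp.1 (hps.le.trans hsV.1.2) ha.value (hS d hds)
  obtain ⟨K, hK⟩ : ∃ K, ∀ e ∈ UqSym M s, EqUpTo K e d → e = d := by
    obtain ⟨k, ⟨hk, hka⟩ | ⟨hk, hka⟩⟩ :=
      exists_tail_eq hq1 hqM.le ha.value hpos (hS d hds) hd.2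
    · exact exists_eqUpTo_imp_eq hrefl hah hS hk hka
    · obtain ⟨K, hK⟩ := exists_eqUpTo_imp_eq (d := refl d) (k := k) hrefl hah hS
        (by rw [refl_apply, val_rev]; have := digit_le (d k); omega) hka
      refine ⟨K, fun e he hed => ?_⟩
      rw [← refl_refl e, hK (refl e) (refl_mem_UqSym hs1 he) fun i hi => by
        rw [refl_apply, refl_apply, hed i hi], refl_refl]
  subst hxd
  exact isolated_of_eqUpTo hp1 hps hsV.1.2 hdp hxpos hK

end Expansions
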